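/- arXiv:2405.17079 — 8 statements merged into one kernel-verified Lean document; each statement's English description precedes it below -/
import Mathlib

section
/- Let ε > 0, let p ∈ [0,1], let B be a Bernoulli random variable with P(B = 1) = p and P(B = 0) = 1 − p, and let W be an independent real random variable with the Laplace distribution of parameter 2/ε. Set Z = B + W. Then for every λ with |λ| ≤ ε/(2√2), E[exp(λ(Z − E[Z]))] ≤ exp((1/8 + 8/ε²) λ²). -/
open MeasureTheory ProbabilityTheory Real

/-- The Laplace distribution with parameter `b > 0`: the measure on `ℝ` with density
`u ↦ exp (-|u| / b) / (2 * b)` with respect to Lebesgue measure. -/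
noncomputable def laplace (b : ℝ) : Measure ℝ :=
  volume.withDensity fun u => ENNReal.ofReal (Real.exp (-|u| / b) / (2 * b))

section

open Set

lemma measurable_laplace_density (b : ℝ) :
    Measurable fun u : ℝ => ENNReal.ofReal (Real.exp (-|u| / b) / (2 * b)) := by
  fun_prop

lemma toReal_laplace_density {b : ℝ} (hb : 0 < b) (u : ℝ) :
    (ENNReal.ofReal (Real.exp (-|u| / b) / (2 * b))).toReal = Real.exp (-|u| / b) / (2 * b) :=
  ENNReal.toReal_ofReal (by positivity)

lemma integrable_laplace_iff {b : ℝ} (hb : 0 < b) {f : ℝ → ℝ} :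
    Integrable f (laplace b) ↔ Integrable fun u => Real.exp (-|u| / b) / (2 * b) * f u := by
  rw [laplace, integrable_withDensity_iff_integrable_smul' (measurable_laplace_density b)
    (Filter.Eventually.of_forall fun _ => ENNReal.ofReal_lt_top)]
  simp only [toReal_laplace_density hb, smul_eq_mul]

lemma integral_laplace {b : ℝ} (hb : 0 < b) (f : ℝ → ℝ) :
    ∫ u, f u ∂(laplace b) = ∫ u, Real.exp (-|u| / b) / (2 * b) * f u := by
  rw [laplace, integral_withDensity_eq_integral_toReal_smul (measurable_laplace_density b)
    (Filter.Eventually.of_forall fun _ => ENNReal.ofReal_lt_top)]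
  simp only [toReal_laplace_density hb, smul_eq_mul]

lemma eqOn_Iic_laplace_density_mul_exp (b t : ℝ) :
    EqOn (fun u => Real.exp (-|u| / b) / (2 * b) * Real.exp (t * u))
      (fun u => 1 / (2 * b) * Real.exp ((t + 1 / b) * u)) (Iic 0) := by
  intro u hu
  simp only
  rw [abs_of_nonpos hu, div_mul_eq_mul_div, ← Real.exp_add]
  ring_nf

lemma eqOn_Ioi_laplace_density_mul_exp (b t : ℝ) :
    EqOn (fun u => Real.exp (-|u| / b) / (2 * b) * Real.exp (t * u))
      (fun u => 1 / (2 * b) * Real.exp ((t - 1 / b) * u)) (Ioi 0) := by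
  intro u hu
  simp only
  rw [abs_of_pos hu, div_mul_eq_mul_div, ← Real.exp_add]
  ring_nf

lemma integrableOn_Iic_laplace_density_mul_exp {b t : ℝ} (ht : |t| < 1 / b) :
    IntegrableOn (fun u => Real.exp (-|u| / b) / (2 * b) * Real.exp (t * u)) (Iic 0) :=
  IntegrableOn.congr_fun ((integrableOn_exp_mul_Iic (by linarith [(abs_lt.1 ht).1]) 0).const_mul _)
    (eqOn_Iic_laplace_density_mul_exp b t).symm measurableSet_Iic

lemma integrableOn_Ioi_laplace_density_mul_exp {b t : ℝ} (ht : |t| < 1 / b) :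
    IntegrableOn (fun u => Real.exp (-|u| / b) / (2 * b) * Real.exp (t * u)) (Ioi 0) :=
  IntegrableOn.congr_fun ((integrableOn_exp_mul_Ioi (by linarith [(abs_lt.1 ht).2]) 0).const_mul _)
    (eqOn_Ioi_laplace_density_mul_exp b t).symm measurableSet_Ioi

lemma integrable_exp_mul_laplace {b t : ℝ} (hb : 0 < b) (ht : |t| < 1 / b) :
    Integrable (fun u => Real.exp (t * u)) (laplace b) := by
  rw [integrable_laplace_iff hb, ← integrableOn_univ, ← Iic_union_Ioi (a := (0 : ℝ))]
  exact (integrableOn_Iic_laplace_density_mul_exp ht).union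
    (integrableOn_Ioi_laplace_density_mul_exp ht)

lemma integral_exp_mul_laplace {b t : ℝ} (hb : 0 < b) (ht : |t| < 1 / b) :
    ∫ u, Real.exp (t * u) ∂(laplace b) = 1 / (1 - (b * t) ^ 2) := by
  obtain ⟨h₁, h₂⟩ := abs_lt.1 ht
  rw [integral_laplace hb, ← intervalIntegral.integral_Iic_add_Ioi
    (integrableOn_Iic_laplace_density_mul_exp ht) (integrableOn_Ioi_laplace_density_mul_exp ht),
    setIntegral_congr_fun measurableSet_Iic (eqOn_Iic_laplace_density_mul_exp b t),
    setIntegral_congr_fun measurableSet_Ioi (eqOn_Ioi_laplace_density_mul_exp b t),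
    integral_const_mul, integral_const_mul, integral_exp_mul_Iic (by linarith),
    integral_exp_mul_Ioi (by linarith)]
  rw [lt_div_iff₀ hb] at h₂
  rw [neg_lt, lt_div_iff₀ hb] at h₁
  have h₃ : 1 + b * t ≠ 0 := by nlinarith
  have h₄ : 1 - b * t ≠ 0 := by nlinarith
  have h₅ : t + 1 / b = (1 + b * t) / b := by field_simp; ring
  have h₆ : t - 1 / b = -(1 - b * t) / b := by field_simp; ring
  have h₇ : 1 - (b * t) ^ 2 = (1 + b * t) * (1 - b * t) := by ring
  rw [h₅, h₆, h₇, mul_zero, mul_zero, Real.exp_zero]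
  field_simp
  ring

lemma integral_id_laplace {b : ℝ} (hb : 0 < b) : ∫ u, u ∂(laplace b) = 0 := by
  rw [integral_laplace hb]
  have h := integral_neg_eq_self (fun u : ℝ => Real.exp (-|u| / b) / (2 * b) * u) volume
  simp only [abs_neg, mul_neg, integral_neg] at h
  linarith

lemma integrable_id_laplace {b : ℝ} (hb : 0 < b) : Integrable (fun u => u) (laplace b) := by
  have hpos : 0 < 1 / (2 * b) := by positivity
  have hlt : 1 / (2 * b) < 1 / b := one_div_lt_one_div_of_lt hb (by linarith)
  simpa using integrable_pow_of_integrable_exp_mul (X := fun u : ℝ => u) hpos.ne'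
    (integrable_exp_mul_laplace hb (by rwa [abs_of_pos hpos]))
    (integrable_exp_mul_laplace hb (by rwa [abs_neg, abs_of_pos hpos])) 1

lemma one_div_one_sub_le_exp_two_mul {x : ℝ} (h₀ : 0 ≤ x) (h₁ : x ≤ 1 / 2) :
    1 / (1 - x) ≤ Real.exp (2 * x) := by
  rw [div_le_iff₀ (by linarith)]
  nlinarith [Real.add_one_le_exp (2 * x)]

lemma integral_exp_mul_laplace_le {b t : ℝ} (hb : 0 < b) (ht : (b * t) ^ 2 ≤ 1 / 2) :
    ∫ u, Real.exp (t * u) ∂(laplace b) ≤ Real.exp (2 * (b * t) ^ 2) := by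
  have hlt : |t| < 1 / b := by
    rw [lt_div_iff₀ hb, ← abs_of_pos hb, ← abs_mul, mul_comm, ← sq_lt_one_iff_abs_lt_one]
    linarith
  rw [integral_exp_mul_laplace hb hlt]
  exact one_div_one_sub_le_exp_two_mul (sq_nonneg _) ht

lemma ae_mem_Icc_of_bernoulli {Ω : Type*} [MeasurableSpace Ω] {μ : Measure Ω}
    [IsProbabilityMeasure μ] {p : ℝ} (hp0 : 0 ≤ p) (hp1 : p ≤ 1) {B : Ω → ℝ} (hB : Measurable B)
    (hB1 : μ {ω | B ω = 1} = ENNReal.ofReal p)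
    (hB0 : μ {ω | B ω = 0} = ENNReal.ofReal (1 - p)) :
    ∀ᵐ ω ∂μ, B ω ∈ Icc (0 : ℝ) 1 := by
  have hm1 : MeasurableSet {ω | B ω = 1} := hB (measurableSet_singleton 1)
  have hm0 : MeasurableSet {ω | B ω = 0} := hB (measurableSet_singleton 0)
  have hdisj : Disjoint {ω | B ω = 1} {ω | B ω = 0} := by
    rw [Set.disjoint_left]
    intro ω h1 h0
    simp only [mem_ofPred_eq] at h1 h0
    linarith
  have hae : ∀ᵐ ω ∂μ, ω ∈ {ω | B ω = 1} ∪ {ω | B ω = 0} := by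
    refine (mem_ae_iff_prob_eq_one (hm1.union hm0)).2 ?_
    rw [measure_union hdisj hm0, hB1, hB0, ← ENNReal.ofReal_add hp0 (by linarith)]
    simp
  filter_upwards [hae] with ω hω
  rcases hω with h | h <;> simp only [mem_ofPred_eq] at h <;> simp [h]

end

/-- Let `ε > 0`, `p ∈ [0,1]`, let `B` be a Bernoulli random variable with `P(B = 1) = p`
and `P(B = 0) = 1 − p`, and let `W` be an independent Laplace(2/ε) random variable.
Set `Z = B + W`. Then for every `λ` with `|λ| ≤ ε / (2√2)`,
`E[exp (λ (Z − E[Z]))] ≤ exp ((1/8 + 8/ε²) λ²)`. -/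
theorem bernoulli_plus_laplace_mgf {Ω : Type*} [MeasurableSpace Ω]
    (μ : Measure Ω) [IsProbabilityMeasure μ]
    (ε : ℝ) (hε : 0 < ε) (p : ℝ) (hp0 : 0 ≤ p) (hp1 : p ≤ 1)
    (B W : Ω → ℝ) (hB : Measurable B) (hW : Measurable W)
    (hB1 : μ {ω | B ω = 1} = ENNReal.ofReal p)
    (hB0 : μ {ω | B ω = 0} = ENNReal.ofReal (1 - p))
    (hindep : IndepFun B W μ)
    (hWlaplace : μ.map W = laplace (2 / ε))
    (l : ℝ) (hl : |l| ≤ ε / (2 * Real.sqrt 2)) :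
    (∫ ω, Real.exp (l * ((B ω + W ω) - ∫ ω', (B ω' + W ω') ∂μ)) ∂μ) ≤
      Real.exp ((1 / 8 + 8 / ε ^ 2) * l ^ 2) := by
  have hb : 0 < 2 / ε := by positivity
  have hBmem := ae_mem_Icc_of_bernoulli hp0 hp1 hB hB1 hB0
  have hWint : Integrable W μ := by
    have h := integrable_id_laplace hb
    rw [← hWlaplace] at h
    exact h.comp_measurable hW
  have hWmean : ∫ ω, W ω ∂μ = 0 := by
    rw [← integral_id_laplace hb, ← hWlaplace,
      integral_map hW.aemeasurable (by fun_prop)]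
  have hmgfW : ∫ ω, Real.exp (l * W ω) ∂μ ≤ Real.exp (8 / ε ^ 2 * l ^ 2) := by
    have hsq : (2 / ε * l) ^ 2 ≤ 1 / 2 := by
      have h := pow_le_pow_left₀ (abs_nonneg l) hl 2
      rw [sq_abs, div_pow, mul_pow, Real.sq_sqrt (by norm_num)] at h
      calc (2 / ε * l) ^ 2 = 4 / ε ^ 2 * l ^ 2 := by ring
        _ ≤ 4 / ε ^ 2 * (ε ^ 2 / (2 ^ 2 * 2)) := by gcongr
        _ = 1 / 2 := by field_simp; norm_num
    calc ∫ ω, Real.exp (l * W ω) ∂μ = ∫ u, Real.exp (l * u) ∂(laplace (2 / ε)) := by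
          rw [← hWlaplace, integral_map hW.aemeasurable (by fun_prop)]
      _ ≤ Real.exp (2 * (2 / ε * l) ^ 2) := integral_exp_mul_laplace_le hb hsq
      _ = Real.exp (8 / ε ^ 2 * l ^ 2) := by ring_nf
  have hmgfB : ∫ ω, Real.exp (l * (B ω - ∫ ω', B ω' ∂μ)) ∂μ ≤ Real.exp (1 / 8 * l ^ 2) := by
    refine ((hasSubgaussianMGF_of_mem_Icc hB.aemeasurable hBmem).mgf_le l).trans_eq ?_
    simp
    ring_nf
  rw [integral_add (Integrable.of_mem_Icc 0 1 hB.aemeasurable hBmem) hWint, hWmean, add_zero]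
  calc ∫ ω, Real.exp (l * ((B ω + W ω) - ∫ ω', B ω' ∂μ)) ∂μ
      = ∫ ω, Real.exp (l * (B ω - ∫ ω', B ω' ∂μ)) * Real.exp (l * W ω) ∂μ := by
        refine integral_congr_ae (Filter.Eventually.of_forall fun ω => ?_)
        simp only [← Real.exp_add]
        ring_nf
    _ = (∫ ω, Real.exp (l * (B ω - ∫ ω', B ω' ∂μ)) ∂μ) * ∫ ω, Real.exp (l * W ω) ∂μ :=
        hindep.integral_fun_comp_mul_comp (f := fun x => Real.exp (l * (x - ∫ ω', B ω' ∂μ)))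
          (g := fun x => Real.exp (l * x)) hB.aemeasurable hW.aemeasurable
          (by fun_prop) (by fun_prop)
    _ ≤ Real.exp (1 / 8 * l ^ 2) * Real.exp (8 / ε ^ 2 * l ^ 2) :=
        mul_le_mul hmgfB hmgfW (integral_nonneg fun _ => (Real.exp_pos _).le) (Real.exp_pos _).le
    _ = Real.exp ((1 / 8 + 8 / ε ^ 2) * l ^ 2) := by
        rw [← Real.exp_add]
        ring_nf
end

section
/- Let Y be an integrable real random variable and let a ≤ b be real numbers. Then E[min(max(Y, a), b)] − E[Y] = ∫₀^∞ P(Y < a − t) dt − ∫₀^∞ P(Y > b + t) dt. -/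
open MeasureTheory Real

/-- The tail formula for the expectation of the positive part of an integrable function. -/
theorem integral_max_zero_eq_integral_meas_lt {Ω : Type*} [MeasurableSpace Ω]
    {P : Measure Ω} {f : Ω → ℝ} (hf : Integrable f P) :
    ∫ ω, max (f ω) 0 ∂P = ∫ t in Set.Ioi (0 : ℝ), (P {ω | t < f ω}).toReal := by
  rw [hf.pos_part.integral_eq_integral_meas_lt (.of_forall fun ω => le_max_right _ _)]
  refine setIntegral_congr_fun measurableSet_Ioi fun t ht => ?_
  have hset : {ω | t < max (f ω) 0} = {ω | t < f ω} := by
    ext ω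
    simp [not_lt_of_gt (Set.mem_Ioi.mp ht)]
  simp only [Measure.real, hset]

/-- Let `Y` be an integrable real random variable and `a ≤ b` real numbers. Then
`E[min (max Y a) b] − E[Y] = ∫₀^∞ P(Y < a − t) dt − ∫₀^∞ P(Y > b + t) dt`. -/
theorem clipped_mean_sub_mean_eq {Ω : Type*} [MeasurableSpace Ω]
    (P : Measure Ω) [IsProbabilityMeasure P]
    (Y : Ω → ℝ) (hY : Measurable Y) (hint : Integrable Y P)
    (a b : ℝ) (hab : a ≤ b) :
    (∫ ω, min (max (Y ω) a) b ∂P) - (∫ ω, Y ω ∂P) =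
      (∫ t in Set.Ioi (0 : ℝ), (P {ω | Y ω < a - t}).toReal) -
        ∫ t in Set.Ioi (0 : ℝ), (P {ω | b + t < Y ω}).toReal := by
  have hlow : Integrable (fun ω => a - Y ω) P := (integrable_const a).sub hint
  have hhigh : Integrable (fun ω => Y ω - b) P := hint.sub (integrable_const b)
  have hclip : Integrable (fun ω => min (max (Y ω) a) b) P :=
    (hint.sup (integrable_const a)).inf (integrable_const b)
  have hlowTail := integral_max_zero_eq_integral_meas_lt hlow
  have hhighTail := integral_max_zero_eq_integral_meas_lt hhigh
  have hlowSet (t : ℝ) : {ω | t < a - Y ω} = {ω | Y ω < a - t} :=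
    Set.ext fun ω => lt_sub_comm (a := t) (b := a) (c := Y ω)
  simp only [hlowSet] at hlowTail
  simp only [lt_sub_iff_add_lt'] at hhighTail
  rw [← hlowTail, ← hhighTail, ← integral_sub hclip hint,
    ← integral_sub hlow.pos_part hhigh.pos_part]
  refine integral_congr_ae (.of_forall fun ω => ?_)
  grind
end

section
/- Let D > 0, let m ≥ 1 and n ≥ 1 be integers, let Y be a real random variable and μ ∈ ℝ such that P(|Y − μ| > t) ≤ 2 exp(−m t² / (2 D²)) for all t > 0. Let b ≥ μ and set Δ = D √(ln n / m). Then ∫₀^∞ P(Y > b + Δ + t) dt ≤ 2 √(2π) D / √(m n). -/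
open MeasureTheory Real

/-- A deviation by more than `D √(ln n / m) + t` gains a factor `1 / √n` over the Gaussian
bound for a deviation by more than `t`. -/
theorem exp_neg_mul_add_sq_le {D t : ℝ} (hD : 0 < D) (ht : 0 ≤ t) {m n : ℕ} (hm : 1 ≤ m)
    (hn : 1 ≤ n) :
    exp (-(m * (D * √(log n / m) + t) ^ 2) / (2 * D ^ 2)) ≤
      1 / √n * exp (-(m / (2 * D ^ 2)) * t ^ 2) := by
  have hm' : (0 : ℝ) < m := by exact_mod_cast hm
  have hn' : (0 : ℝ) < n := by exact_mod_cast hn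
  have hlog : 0 ≤ log n / m := div_nonneg (log_natCast_nonneg n) hm'.le
  have hsqrt : 1 / √(n : ℝ) = exp (-(log n / 2)) := by
    rw [exp_neg, ← log_sqrt hn'.le, exp_log (sqrt_pos.mpr hn'), one_div]
  have hsq : m * (D * √(log n / m)) ^ 2 = D ^ 2 * log n := by
    rw [mul_pow, sq_sqrt hlog]
    field_simp
  have hcross : 0 ≤ m * (2 * (D * √(log n / m)) * t) := by positivity
  rw [hsqrt, ← exp_add, exp_le_exp]
  calc -(m * (D * √(log n / m) + t) ^ 2) / (2 * D ^ 2)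
      ≤ -(D ^ 2 * log n + m * t ^ 2) / (2 * D ^ 2) := by
        gcongr
        linarith
    _ = -(log n / 2) + -(m / (2 * D ^ 2)) * t ^ 2 := by
        field_simp
        ring

/-- Let `D > 0`, `m, n ≥ 1`, and let `Y` be a real random variable with
`P(|Y − μ| > t) ≤ 2 exp (−m t² / (2 D²))` for all `t > 0`. Let `b ≥ μ` and set
`Δ = D √(ln n / m)`. Then `∫₀^∞ P(Y > b + Δ + t) dt ≤ 2 √(2π) D / √(m n)`. -/
theorem tail_integral_le {Ω : Type*} [MeasurableSpace Ω]
    (P : Measure Ω) [IsProbabilityMeasure P]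
    (D : ℝ) (hD : 0 < D) (m n : ℕ) (hm : 1 ≤ m) (hn : 1 ≤ n)
    (Y : Ω → ℝ) (hY : Measurable Y) (μ : ℝ)
    (htail : ∀ t : ℝ, 0 < t →
      P {ω | t < |Y ω - μ|} ≤ ENNReal.ofReal (2 * Real.exp (-(m * t ^ 2) / (2 * D ^ 2))))
    (b : ℝ) (hb : μ ≤ b) :
    (∫ t in Set.Ioi (0 : ℝ),
        (P {ω | b + D * Real.sqrt (Real.log n / m) + t < Y ω}).toReal) ≤
      2 * Real.sqrt (2 * Real.pi) * D / Real.sqrt (m * n) := by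
  have hm' : (0 : ℝ) < m := by exact_mod_cast hm
  have hn' : (0 : ℝ) < n := by exact_mod_cast hn
  have hc : (0 : ℝ) < m / (2 * D ^ 2) := by positivity
  have hbound : ∀ t ∈ Set.Ioi (0 : ℝ),
      (P {ω | b + D * √(log n / m) + t < Y ω}).toReal ≤
        2 * (1 / √n) * exp (-(m / (2 * D ^ 2)) * t ^ 2) := by
    intro t ht
    have ht : 0 < t := ht
    have hs : 0 < D * √(log n / m) + t := by positivity
    have hsub : {ω | b + D * √(log n / m) + t < Y ω} ⊆
        {ω | D * √(log n / m) + t < |Y ω - μ|} := fun ω (hω : _ < Y ω) =>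
      lt_of_lt_of_le (by linarith) (le_abs_self (Y ω - μ))
    have htoReal := ENNReal.toReal_le_of_le_ofReal (by positivity)
      ((measure_mono hsub).trans (htail _ hs))
    linarith [exp_neg_mul_add_sq_le hD ht.le hm hn]
  have hint : √(π / (m / (2 * D ^ 2))) = √(2 * π) * D / √m := by
    rw [show π / (m / (2 * D ^ 2)) = 2 * π * D ^ 2 / m by field_simp,
      sqrt_div (by positivity), sqrt_mul (by positivity), sqrt_sq hD.le]
  calc ∫ t in Set.Ioi (0 : ℝ), (P {ω | b + D * √(log n / m) + t < Y ω}).toReal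
      ≤ ∫ t in Set.Ioi (0 : ℝ), 2 * (1 / √n) * exp (-(m / (2 * D ^ 2)) * t ^ 2) :=
        integral_mono_of_nonneg (Filter.Eventually.of_forall fun _ => ENNReal.toReal_nonneg)
          ((integrable_exp_neg_mul_sq hc).integrableOn.const_mul _)
          ((ae_restrict_iff' measurableSet_Ioi).mpr (Filter.Eventually.of_forall hbound))
    _ = √(2 * π) * D / √(m * n) := by
        rw [integral_const_mul, integral_gaussian_Ioi, hint, sqrt_mul hm'.le]
        field_simp
    _ ≤ 2 * √(2 * π) * D / √(m * n) := by
        gcongr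
        linarith [sqrt_nonneg (2 * π)]
end

section
/- Let W be an integrable real random variable with mean μ = E[W]. Let A > 0, p > 1, t₀ > 0 and suppose P(|W − μ| > t) ≤ A t^{−p} for all t ≥ t₀. If D ≥ 2|μ| and D ≥ 2 t₀, then |E[min(max(W, −D), D)] − μ| ≤ 2^{p+1} A D^{1−p} / (p − 1). -/
open MeasureTheory Real

lemma integral_max_sub_le_of_tail_le {Ω : Type*} [MeasurableSpace Ω]
    {P : Measure Ω} {Y : Ω → ℝ} {A p c : ℝ}
    (hint : Integrable (fun ω ↦ max (Y ω - c) 0) P)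
    (hA : 0 ≤ A) (hp : 1 < p) (hc : 0 < c)
    (htail : ∀ t, c ≤ t → P {ω | t < Y ω} ≤ ENNReal.ofReal (A * t ^ (-p))) :
    ∫ ω, max (Y ω - c) 0 ∂P ≤ A * c ^ (1 - p) / (p - 1) := by
  have hp' : -p < -1 := by linarith
  have hval : ∫ t in Set.Ioi 0, (t + c) ^ (-p) = c ^ (1 - p) / (p - 1) := by
    have h := (measurePreserving_add_right volume c).setIntegral_preimage_emb
      (measurableEmbedding_addRight c) (fun t : ℝ ↦ t ^ (-p)) (Set.Ioi c)
    rw [Set.preimage_add_const_Ioi, sub_self] at h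
    rw [h, integral_Ioi_rpow_of_lt hp' hc, ← neg_div_neg_eq]
    ring_nf
  rw [hint.integral_eq_integral_meas_lt (.of_forall fun _ ↦ le_max_right _ _), mul_div_assoc,
    ← hval, ← integral_const_mul]
  refine integral_mono_of_nonneg (.of_forall fun _ ↦ measureReal_nonneg)
    ((integrableOn_add_rpow_Ioi_of_lt hp' (by linarith)).const_mul A) ?_
  filter_upwards [ae_restrict_mem measurableSet_Ioi] with t ht
  rw [Set.mem_Ioi] at ht
  refine ENNReal.toReal_le_of_le_ofReal (by positivity) (le_trans (measure_mono ?_)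
    (htail (t + c) (by linarith)))
  intro ω (hω : t < max (Y ω - c) 0)
  rcases lt_max_iff.1 hω with h | h
  · exact lt_sub_iff_add_lt.1 h
  · exact absurd h ht.not_gt

lemma abs_clip_sub_le {x m D : ℝ} (hD : 2 * |m| ≤ D) :
    |min (max x (-D)) D - x| ≤ max (|x - m| - D / 2) 0 := by
  have h1 := le_abs_self m
  have h2 := neg_abs_le m
  have h3 := le_abs_self (x - m)
  have h4 := neg_abs_le (x - m)
  have h5 := abs_nonneg m
  have h6 := le_max_left (|x - m| - D / 2) 0
  have h7 := le_max_right (|x - m| - D / 2) 0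
  rw [abs_le]
  rcases le_total x (-D) with h | h
  · rw [max_eq_right h, min_eq_left (by linarith)]
    constructor <;> linarith
  · rw [max_eq_left h]
    rcases le_total x D with h' | h'
    · rw [min_eq_left h']
      constructor <;> linarith
    · rw [min_eq_right h']
      constructor <;> linarith

/-- Let `W` be an integrable real random variable with mean `μ = E[W]`. Let `A > 0`,
`p > 1`, `t₀ > 0` and suppose `P(|W − μ| > t) ≤ A t^(−p)` for all `t ≥ t₀`. If
`D ≥ 2|μ|` and `D ≥ 2 t₀`, then
`|E[min (max W (−D)) D] − μ| ≤ 2^(p+1) A D^(1−p) / (p − 1)`. -/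
theorem clipping_bias_le {Ω : Type*} [MeasurableSpace Ω]
    (P : Measure Ω) [IsProbabilityMeasure P]
    (W : Ω → ℝ) (hW : Measurable W) (hint : Integrable W P)
    (A p t₀ D : ℝ) (hA : 0 < A) (hp : 1 < p) (ht₀ : 0 < t₀)
    (htail : ∀ t : ℝ, t₀ ≤ t →
      P {ω | t < |W ω - ∫ ω', W ω' ∂P|} ≤ ENNReal.ofReal (A * t ^ (-p)))
    (hD1 : 2 * |∫ ω, W ω ∂P| ≤ D) (hD2 : 2 * t₀ ≤ D) :
    |(∫ ω, min (max (W ω) (-D)) D ∂P) - ∫ ω, W ω ∂P| ≤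
      2 ^ (p + 1) * A * D ^ (1 - p) / (p - 1) := by
  set m := ∫ ω, W ω ∂P
  have hD : 0 < D := by linarith
  have hexc : Integrable (fun ω ↦ max (|W ω - m| - D / 2) 0) P :=
    ((hint.sub (integrable_const m)).abs.sub (integrable_const _)).pos_part
  have hdiff : Integrable (fun ω ↦ min (max (W ω) (-D)) D - W ω) P :=
    hexc.mono' (by fun_prop) (.of_forall fun _ ↦ abs_clip_sub_le hD1)
  have hclip : Integrable (fun ω ↦ min (max (W ω) (-D)) D) P :=
    (hdiff.add hint).congr (.of_forall fun _ ↦ sub_add_cancel _ _)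
  calc |(∫ ω, min (max (W ω) (-D)) D ∂P) - m|
      = |∫ ω, (min (max (W ω) (-D)) D - W ω) ∂P| := by rw [integral_sub hclip hint]
    _ ≤ ∫ ω, |min (max (W ω) (-D)) D - W ω| ∂P := abs_integral_le_integral_abs
    _ ≤ ∫ ω, max (|W ω - m| - D / 2) 0 ∂P :=
        integral_mono hdiff.abs hexc fun _ ↦ abs_clip_sub_le hD1
    _ ≤ A * (D / 2) ^ (1 - p) / (p - 1) :=
        integral_max_sub_le_of_tail_le hexc hA.le hp (by linarith)
          fun t ht ↦ htail t (by linarith)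
    _ = 2 ^ (p - 1) * A * D ^ (1 - p) / (p - 1) := by
        rw [div_rpow hD.le zero_le_two, div_eq_mul_inv (D ^ (1 - p)), ← rpow_neg zero_le_two,
          neg_sub]
        ring
    _ ≤ 2 ^ (p + 1) * A * D ^ (1 - p) / (p - 1) := by
        have : 0 < p - 1 := by linarith
        gcongr
        · exact one_le_two
        · linarith
end

section
/- Let E be a finite-dimensional real inner product space, let 0 < γ ≤ G, and let L : E → ℝ be differentiable with G-Lipschitz gradient ∇L and γ-strongly convex, i.e. the function θ ↦ L(θ) − (γ/2)‖θ‖² is convex. Let θ* be the global minimizer of L and let 0 < η ≤ 1/G. Then for every θ ∈ E, ‖θ − η ∇L(θ) − θ*‖² ≤ (1 − η γ) ‖θ − θ*‖². -/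
open Real

theorem HasGradientAt.hasDerivAt_add_smul {E : Type*} [NormedAddCommGroup E]
    [InnerProductSpace ℝ E] [CompleteSpace E] {f : E → ℝ} {f' x v : E} {t : ℝ}
    (hf : HasGradientAt f f' (x + t • v)) :
    HasDerivAt (fun s : ℝ => f (x + s • v)) (inner ℝ f' v) t := by
  have hline : HasDerivAt (fun s : ℝ => x + s • v) v t := by
    simpa using ((hasDerivAt_id t).smul_const v).const_add x
  simpa [Function.comp_def] using hf.hasFDerivAt.comp_hasDerivAt t hline

/-- The gradient inequality for a convex function. -/
theorem ConvexOn.add_inner_le_of_hasGradientAt {E : Type*} [NormedAddCommGroup E]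
    [InnerProductSpace ℝ E] [CompleteSpace E] {f : E → ℝ} {f' x : E}
    (hf : ConvexOn ℝ Set.univ f) (hf' : HasGradientAt f f' x) (v : E) :
    f x + inner ℝ f' v ≤ f (x + v) := by
  have hconv : ConvexOn ℝ Set.univ (fun t : ℝ => f (x + t • v)) := by
    have h := hf.comp_affineMap (AffineMap.lineMap x (x + v) : ℝ →ᵃ[ℝ] E)
    simpa [Function.comp_def, AffineMap.lineMap_apply, add_comm] using h
  have hderiv : HasDerivAt (fun t : ℝ => f (x + t • v)) (inner ℝ f' v) 0 :=
    HasGradientAt.hasDerivAt_add_smul (by simpa using hf')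
  have h := hconv.le_slope_of_hasDerivAt (Set.mem_univ 0) (Set.mem_univ 1) one_pos hderiv
  simp [slope_def_field] at h
  linarith

/-- The quadratic lower bound for a strongly convex function. -/
theorem add_inner_add_le_of_convexOn_sub_norm_sq {E : Type*} [NormedAddCommGroup E]
    [InnerProductSpace ℝ E] [CompleteSpace E] {f : E → ℝ} {f' x : E} {γ : ℝ}
    (hf : ConvexOn ℝ Set.univ (fun y => f y - γ / 2 * ‖y‖ ^ 2))
    (hf' : HasGradientAt f f' x) (v : E) :
    f x + inner ℝ f' v + γ / 2 * ‖v‖ ^ 2 ≤ f (x + v) := by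
  have hgrad : HasGradientAt (fun y => f y - γ / 2 * ‖y‖ ^ 2) (f' - γ • x) x := by
    rw [hasGradientAt_iff_hasFDerivAt]
    refine (hf'.hasFDerivAt.sub
      ((hasStrictFDerivAt_norm_sq x).hasFDerivAt.const_mul (γ / 2))).congr_fderiv ?_
    ext w
    simp
    ring
  have h := hf.add_inner_le_of_hasGradientAt hgrad v
  rw [norm_add_sq_real, inner_sub_left, real_inner_smul_left] at h
  linarith

/-- The descent lemma: the quadratic upper bound for a function with Lipschitz gradient. -/
theorem le_add_inner_add_of_gradient_lipschitz {E : Type*} [NormedAddCommGroup E]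
    [InnerProductSpace ℝ E] [CompleteSpace E] {f : E → ℝ} {g : E → E} {G : ℝ}
    (hf : ∀ x, HasGradientAt f (g x) x) (hg : ∀ x y, ‖g x - g y‖ ≤ G * ‖x - y‖) (x v : E) :
    f (x + v) ≤ f x + inner ℝ (g x) v + G / 2 * ‖v‖ ^ 2 := by
  have hderiv (t : ℝ) : HasDerivAt
      (fun s : ℝ => f (x + s • v) - s * inner ℝ (g x) v - G / 2 * ‖v‖ ^ 2 * s ^ 2)
      (inner ℝ (g (x + t • v)) v - inner ℝ (g x) v - G * ‖v‖ ^ 2 * t) t := by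
    refine (((hf (x + t • v)).hasDerivAt_add_smul.sub
      ((hasDerivAt_id t).mul_const (inner ℝ (g x) v))).sub
      ((hasDerivAt_pow 2 t).const_mul (G / 2 * ‖v‖ ^ 2))).congr_deriv ?_
    norm_num
    ring
  have hanti : AntitoneOn
      (fun s : ℝ => f (x + s • v) - s * inner ℝ (g x) v - G / 2 * ‖v‖ ^ 2 * s ^ 2)
      (Set.Ici 0) := by
    refine antitoneOn_of_deriv_nonpos (convex_Ici 0)
      (fun t _ => (hderiv t).continuousAt.continuousWithinAt)
      (fun t _ => (hderiv t).differentiableAt.differentiableWithinAt) fun t ht => ?_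
    rw [interior_Ici, Set.mem_Ioi] at ht
    rw [(hderiv t).deriv, ← inner_sub_left, sub_nonpos]
    calc inner ℝ (g (x + t • v) - g x) v
        ≤ ‖g (x + t • v) - g x‖ * ‖v‖ := real_inner_le_norm _ _
      _ ≤ G * ‖x + t • v - x‖ * ‖v‖ := by gcongr; exact hg _ _
      _ = G * ‖v‖ ^ 2 * t := by
        rw [add_sub_cancel_left, norm_smul, Real.norm_of_nonneg ht.le]
        ring
  have h := hanti (Set.mem_Ici.2 le_rfl) (Set.mem_Ici.2 zero_le_one) zero_le_one
  simp at h
  linarith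

/-- Let `E` be a finite-dimensional real inner product space, `0 < γ ≤ G`, and let
`L : E → ℝ` be differentiable with `G`-Lipschitz gradient `g` and `γ`-strongly convex
(i.e. `θ ↦ L θ − (γ/2)‖θ‖²` is convex). Let `θ*` be the global minimizer of `L` and
`0 < η ≤ 1/G`. Then for every `θ`,
`‖θ − η ∇L(θ) − θ*‖² ≤ (1 − η γ) ‖θ − θ*‖²`. -/
theorem gradient_step_contraction {E : Type*} [NormedAddCommGroup E]
    [InnerProductSpace ℝ E] [FiniteDimensional ℝ E]
    (γ G : ℝ) (hγ : 0 < γ) (hγG : γ ≤ G)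
    (L : E → ℝ) (g : E → E)
    (hgrad : ∀ θ, HasGradientAt L (g θ) θ)
    (hlip : ∀ θ θ' : E, ‖g θ - g θ'‖ ≤ G * ‖θ - θ'‖)
    (hconv : ConvexOn ℝ Set.univ (fun θ => L θ - γ / 2 * ‖θ‖ ^ 2))
    (θstar : E) (hmin : ∀ θ, L θstar ≤ L θ)
    (η : ℝ) (hη0 : 0 < η) (hη : η ≤ 1 / G) (θ : E) :
    ‖θ - η • g θ - θstar‖ ^ 2 ≤ (1 - η * γ) * ‖θ - θstar‖ ^ 2 := by
  have hdescent := le_add_inner_add_of_gradient_lipschitz hgrad hlip θ (-(η • g θ))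
  have hlower := add_inner_add_le_of_convexOn_sub_norm_sq hconv (hgrad θ) (-(θ - θstar))
  have hle := (hmin (θ + -(η • g θ))).trans hdescent
  rw [inner_neg_right, real_inner_smul_right, real_inner_self_eq_norm_sq, norm_neg,
    norm_smul, Real.norm_of_nonneg hη0.le, mul_pow] at hle
  rw [inner_neg_right, norm_neg, show θ + -(θ - θstar) = θstar by abel] at hlower
  have hηG : η * G ≤ 1 := (le_div_iff₀ (hγ.trans_le hγG)).1 hη
  have hquad : η * G * (η * ‖g θ‖ ^ 2) ≤ 1 * (η * ‖g θ‖ ^ 2) := by gcongr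
  have hgap : η / 2 * ‖g θ‖ ^ 2 + γ / 2 * ‖θ - θstar‖ ^ 2 ≤ inner ℝ (g θ) (θ - θstar) := by
    linarith
  have hscaled := mul_le_mul_of_nonneg_left hgap (by positivity : 0 ≤ 2 * η)
  rw [show θ - η • g θ - θstar = (θ - θstar) - η • g θ by abel, norm_sub_sq_real,
    real_inner_smul_right, real_inner_comm, norm_smul, Real.norm_of_nonneg hη0.le, mul_pow]
  linarith
end

section
/- Let Z be a real random variable and let C_a > 0 and γ > 0 be constants such that P(|Z| < t) ≤ C_a t^γ for all t > 0. Then for every s > 0, E[|Z| · exp(−s Z²)] ≤ 2^{γ/2} · C_a · e^{−1/2} · Γ(γ/2 + 1) · s^{−(1+γ)/2}. -/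
open MeasureTheory Real

lemma lintegral_Ioi_exp_neg (c : ℝ) :
    ∫⁻ v in Set.Ioi c, ENNReal.ofReal (exp (-v)) = ENNReal.ofReal (exp (-c)) := by
  rw [← ofReal_integral_eq_lintegral_ofReal (integrableOn_exp_neg_Ioi c)
    (ae_of_all _ fun v => (exp_pos _).le), integral_exp_neg_Ioi]

/-- Layer-cake formula for the Laplace transform of a nonnegative random variable at `1`. -/
lemma lintegral_exp_neg_eq {Ω : Type*} [MeasurableSpace Ω] (P : Measure Ω) [SFinite P]
    {Y : Ω → ℝ} (hY : Measurable Y) (hY0 : ∀ ω, 0 ≤ Y ω) :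
    ∫⁻ ω, ENNReal.ofReal (exp (-Y ω)) ∂P =
      ∫⁻ v in Set.Ioi (0 : ℝ), ENNReal.ofReal (exp (-v)) * P {ω | Y ω < v} := by
  have hS : MeasurableSet {p : Ω × ℝ | Y p.1 < p.2} :=
    measurableSet_lt (hY.comp measurable_fst) measurable_snd
  have hF : Measurable (Function.uncurry fun (ω : Ω) (v : ℝ) =>
      {p : Ω × ℝ | Y p.1 < p.2}.indicator (fun p => ENNReal.ofReal (exp (-p.2))) (ω, v)) :=
    Measurable.indicator (by fun_prop) hS
  calc
    _ = ∫⁻ ω, (∫⁻ v in Set.Ioi (0 : ℝ), {p : Ω × ℝ | Y p.1 < p.2}.indicator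
          (fun p => ENNReal.ofReal (exp (-p.2))) (ω, v)) ∂P := by
      refine lintegral_congr fun ω => ?_
      rw [← lintegral_Ioi_exp_neg]
      have h : ∀ v : ℝ, {p : Ω × ℝ | Y p.1 < p.2}.indicator
          (fun p => ENNReal.ofReal (exp (-p.2))) (ω, v) =
          (Set.Ioi (Y ω)).indicator (fun v => ENNReal.ofReal (exp (-v))) v := fun v => by
        simp [Set.indicator_apply]
      simp_rw [h]
      rw [lintegral_indicator measurableSet_Ioi, Measure.restrict_restrict measurableSet_Ioi,
        Set.inter_eq_left.2 (Set.Ioi_subset_Ioi (hY0 ω))]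
    _ = _ := by
      rw [lintegral_lintegral_swap hF.aemeasurable]
      refine lintegral_congr fun v => ?_
      have h : ∀ ω : Ω, {p : Ω × ℝ | Y p.1 < p.2}.indicator
          (fun p => ENNReal.ofReal (exp (-p.2))) (ω, v) =
          {ω | Y ω < v}.indicator (fun _ => ENNReal.ofReal (exp (-v))) ω := fun ω => by
        simp [Set.indicator_apply]
      simp_rw [h]
      rw [lintegral_indicator_const (measurableSet_lt hY measurable_const)]

/-- A small-ball estimate at `0` bounds the Laplace transform of the square. -/
lemma lintegral_exp_neg_mul_sq_le {Ω : Type*} [MeasurableSpace Ω] (P : Measure Ω) [SFinite P]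
    {Z : Ω → ℝ} (hZ : Measurable Z) {C γ : ℝ} (hC : 0 ≤ C) (hγ : 0 ≤ γ)
    (hsmall : ∀ t : ℝ, 0 < t → P {ω | |Z ω| < t} ≤ ENNReal.ofReal (C * t ^ γ))
    {a : ℝ} (ha : 0 < a) :
    ∫⁻ ω, ENNReal.ofReal (exp (-(a * Z ω ^ 2))) ∂P ≤
      ENNReal.ofReal (C * a ^ (-(γ / 2)) * Gamma (γ / 2 + 1)) := by
  have hint : IntegrableOn (fun v : ℝ => C * a ^ (-(γ / 2)) * (exp (-v) * v ^ (γ / 2 + 1 - 1)))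
      (Set.Ioi 0) := (GammaIntegral_convergent (by positivity)).const_mul _
  rw [lintegral_exp_neg_eq P (by fun_prop) fun ω => by positivity,
    Gamma_eq_integral (by positivity), ← integral_const_mul,
    ofReal_integral_eq_lintegral_ofReal hint]
  · refine setLIntegral_mono' measurableSet_Ioi fun v hv => ?_
    have hv : 0 < v := hv
    have hset : {ω | a * Z ω ^ 2 < v} = {ω | |Z ω| < √(v / a)} := by
      ext ω
      simp only [Set.mem_ofPred_eq]
      rw [lt_sqrt (abs_nonneg _), sq_abs, lt_div_iff₀ ha, mul_comm]
    have hpow : √(v / a) ^ γ = a ^ (-(γ / 2)) * v ^ (γ / 2) := by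
      rw [sqrt_eq_rpow, ← rpow_mul (by positivity), div_rpow hv.le ha.le, rpow_neg ha.le,
        show 1 / 2 * γ = γ / 2 by ring]
      ring
    calc
      _ ≤ ENNReal.ofReal (exp (-v)) * ENNReal.ofReal (C * √(v / a) ^ γ) := by
        rw [hset]
        gcongr
        exact hsmall _ (by positivity)
      _ = _ := by
        rw [← ENNReal.ofReal_mul (exp_pos _).le, hpow, add_sub_cancel_right]
        congr 1
        ring
  · refine (ae_restrict_iff' measurableSet_Ioi).2 (ae_of_all _ fun v hv => ?_)
    have hv : 0 < v := hv
    simp only [Pi.zero_apply]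
    positivity

lemma abs_mul_exp_neg_half_mul_sq_le {s : ℝ} (hs : 0 < s) (z : ℝ) :
    |z| * exp (-(s / 2 * z ^ 2)) ≤ s ^ (-(1 / 2) : ℝ) * exp (-1 / 2) := by
  have h1 : √s * |z| ≤ exp ((s * z ^ 2 - 1) / 2) := by
    have h2 := add_one_le_exp ((s * z ^ 2 - 1) / 2)
    nlinarith [sq_nonneg (√s * |z| - 1), sq_sqrt hs.le, sq_abs z, mul_pow (√s) |z| 2]
  have h3 : exp ((s * z ^ 2 - 1) / 2) * exp (-(s / 2 * z ^ 2)) = exp (-1 / 2) := by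
    rw [← exp_add]
    ring_nf
  rw [rpow_neg hs.le, ← sqrt_eq_rpow, ← h3, inv_mul_eq_div, le_div_iff₀ (sqrt_pos.2 hs)]
  nlinarith [mul_le_mul_of_nonneg_right h1 (exp_pos (-(s / 2 * z ^ 2))).le]

/-- Let `Z` be a real random variable with `P(|Z| < t) ≤ C_a t^γ` for all `t > 0`, where
`C_a > 0` and `γ > 0`. Then for every `s > 0`,
`E[|Z| exp (−s Z²)] ≤ 2^{γ/2} C_a e^{−1/2} Γ(γ/2 + 1) s^{−(1+γ)/2}`. -/
theorem abs_mul_exp_neg_sq_expectation_le {Ω : Type*} [MeasurableSpace Ω]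
    (P : Measure Ω) [IsProbabilityMeasure P]
    (Z : Ω → ℝ) (hZ : Measurable Z)
    (Ca γ : ℝ) (hCa : 0 < Ca) (hγ : 0 < γ)
    (hsmall : ∀ t : ℝ, 0 < t → P {ω | |Z ω| < t} ≤ ENNReal.ofReal (Ca * t ^ γ))
    (s : ℝ) (hs : 0 < s) :
    (∫ ω, |Z ω| * Real.exp (-s * Z ω ^ 2) ∂P) ≤
      2 ^ (γ / 2) * Ca * Real.exp (-1 / 2) * Real.Gamma (γ / 2 + 1) *
        s ^ (-(1 + γ) / 2) := by
  have hexp : Measurable fun ω => exp (-(s / 2 * Z ω ^ 2)) := by fun_prop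
  have hlap : ∫ ω, exp (-(s / 2 * Z ω ^ 2)) ∂P ≤
      Ca * (s / 2) ^ (-(γ / 2)) * Gamma (γ / 2 + 1) := by
    rw [integral_eq_lintegral_of_nonneg_ae (ae_of_all _ fun ω => (exp_pos _).le)
      hexp.aestronglyMeasurable]
    exact ENNReal.toReal_le_of_le_ofReal (by positivity)
      (lintegral_exp_neg_mul_sq_le P hZ hCa.le hγ.le hsmall (half_pos hs))
  have hint : Integrable (fun ω => exp (-(s / 2 * Z ω ^ 2))) P := by
    refine Integrable.of_bound hexp.aestronglyMeasurable 1 (ae_of_all _ fun ω => ?_)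
    rw [norm_of_nonneg (exp_pos _).le, exp_le_one_iff, neg_nonpos]
    positivity
  calc
    _ ≤ ∫ ω, s ^ (-(1 / 2) : ℝ) * exp (-1 / 2) * exp (-(s / 2 * Z ω ^ 2)) ∂P := by
      refine integral_mono_of_nonneg (ae_of_all _ fun ω => ?_) (hint.const_mul _)
        (ae_of_all _ fun ω => ?_)
      · simp only [Pi.zero_apply]
        positivity
      · have hsplit : exp (-s * Z ω ^ 2) =
            exp (-(s / 2 * Z ω ^ 2)) * exp (-(s / 2 * Z ω ^ 2)) := by
          rw [← exp_add]
          ring_nf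
        simp only [hsplit, ← mul_assoc]
        exact mul_le_mul_of_nonneg_right (abs_mul_exp_neg_half_mul_sq_le hs (Z ω)) (exp_pos _).le
    _ ≤ s ^ (-(1 / 2) : ℝ) * exp (-1 / 2) *
          (Ca * (s / 2) ^ (-(γ / 2)) * Gamma (γ / 2 + 1)) := by
      rw [integral_const_mul]
      gcongr
    _ = _ := by
      rw [div_rpow hs.le zero_le_two, rpow_neg zero_le_two, div_inv_eq_mul,
        show -(1 + γ) / 2 = -(1 / 2) + -(γ / 2) by ring, rpow_add hs]
      ring
end

section
/- Let ε ≥ 0 and let μ and ν be probability measures on a measurable space (Ω, 𝔉) such that μ(S) ≤ e^ε ν(S) and ν(S) ≤ e^ε μ(S) for every measurable set S. Then KL(μ‖ν) ≤ ε (e^ε − 1). -/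
open MeasureTheory Real ENNReal Classical

/-- The Kullback–Leibler divergence `KL(μ‖ν)`, defined as `∫ log (dμ/dν) dμ` when `μ` is
absolutely continuous with respect to `ν`, and `+∞` otherwise. -/
noncomputable def klDiv {Ω : Type*} [MeasurableSpace Ω] (μ ν : Measure Ω) : ℝ≥0∞ :=
  if μ ≪ ν then ENNReal.ofReal (∫ x, Real.log (μ.rnDeriv ν x).toReal ∂μ) else ⊤

/-- On `[e^{-ε}, e^ε]` one has `x log x ≤ ε (e^ε - 1) + (x - 1)`. -/
theorem mul_log_le_of_log_abs_le {x ε : ℝ} (hx : 0 < x) (h : |log x| ≤ ε) :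
    x * log x ≤ ε * (exp ε - 1) + (x - 1) := by
  have h0 : log x ≤ x - 1 := log_le_sub_one_of_pos hx
  have hε : 0 ≤ ε := (abs_nonneg _).trans h
  have hxle : x ≤ exp ε := (log_le_iff_le_exp hx).1 ((le_abs_self _).trans h)
  have hxge : exp (-ε) ≤ x := (le_log_iff_exp_le hx).1 (neg_le_of_abs_le h)
  have hsum : 2 ≤ exp ε + exp (-ε) := by
    have := one_le_cosh ε
    rw [cosh_eq] at this
    linarith
  have hdiff : |x - 1| ≤ exp ε - 1 := abs_le.2 ⟨by linarith, by linarith⟩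
  have hmul : (x - 1) * log x ≤ (exp ε - 1) * ε :=
    (le_abs_self _).trans <| (abs_mul _ _).trans_le <|
      mul_le_mul hdiff h (abs_nonneg _) ((abs_nonneg _).trans hdiff)
  linarith

/-- Let `ε ≥ 0` and let `μ`, `ν` be probability measures with `μ(S) ≤ e^ε ν(S)` and
`ν(S) ≤ e^ε μ(S)` for every measurable set `S`. Then `KL(μ‖ν) ≤ ε (e^ε − 1)`. -/
theorem kl_le_of_dp_close {Ω : Type*} [MeasurableSpace Ω]
    (μ ν : Measure Ω) [IsProbabilityMeasure μ] [IsProbabilityMeasure ν]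
    (ε : ℝ) (hε : 0 ≤ ε)
    (h1 : ∀ S : Set Ω, MeasurableSet S → μ S ≤ ENNReal.ofReal (Real.exp ε) * ν S)
    (h2 : ∀ S : Set Ω, MeasurableSet S → ν S ≤ ENNReal.ofReal (Real.exp ε) * μ S) :
    klDiv μ ν ≤ ENNReal.ofReal (ε * (Real.exp ε - 1)) := by
  have hμν : μ ≪ ν := Measure.AbsolutelyContinuous.mk fun S hS h0 ↦ by simpa [h0] using h1 S hS
  have hm : Measurable (μ.rnDeriv ν) := Measure.measurable_rnDeriv μ ν
  have hset (S : Set Ω) : ∫⁻ x in S, μ.rnDeriv ν x ∂ν = μ S :=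
    Measure.setLIntegral_rnDeriv hμν S
  have hup : μ.rnDeriv ν ≤ᵐ[ν] fun _ ↦ ENNReal.ofReal (exp ε) :=
    ae_le_of_forall_setLIntegral_le_of_sigmaFinite hm fun S hS _ ↦ by
      rw [hset, setLIntegral_const]
      exact h1 S hS
  have hlo : (fun _ ↦ 1) ≤ᵐ[ν] fun x ↦ ENNReal.ofReal (exp ε) * μ.rnDeriv ν x :=
    ae_le_of_forall_setLIntegral_le_of_sigmaFinite measurable_const fun S hS _ ↦ by
      rw [lintegral_const_mul _ hm, hset, setLIntegral_const, one_mul]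
      exact h2 S hS
  have hbound : ∀ᵐ x ∂ν, 0 < (μ.rnDeriv ν x).toReal ∧ (μ.rnDeriv ν x).toReal ≤ exp ε ∧
      |log (μ.rnDeriv ν x).toReal| ≤ ε := by
    filter_upwards [hup, hlo] with x hxu hxl
    have hu : (μ.rnDeriv ν x).toReal ≤ exp ε := ENNReal.toReal_le_of_le_ofReal (exp_pos ε).le hxu
    have hl : 1 ≤ exp ε * (μ.rnDeriv ν x).toReal := by
      have hfin : ENNReal.ofReal (exp ε) * μ.rnDeriv ν x ≠ ∞ :=
        ENNReal.mul_ne_top ofReal_ne_top (ne_top_of_le_ne_top ofReal_ne_top hxu)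
      simpa [(exp_pos ε).le] using ENNReal.toReal_mono hfin hxl
    have hpos : 0 < (μ.rnDeriv ν x).toReal :=
      pos_of_mul_pos_right (one_pos.trans_le hl) (exp_pos ε).le
    refine ⟨hpos, hu, abs_le.2 ⟨?_, (log_le_iff_le_exp hpos).2 hu⟩⟩
    rw [le_log_iff_exp_le hpos, exp_neg]
    exact (inv_le_iff_one_le_mul₀' (exp_pos ε)).2 hl
  have hint : Integrable
      (fun x ↦ (μ.rnDeriv ν x).toReal * log (μ.rnDeriv ν x).toReal) ν := by
    refine Integrable.of_bound (C := exp ε * ε) ?_ ?_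
    · exact (hm.ennreal_toReal.mul hm.ennreal_toReal.log).aestronglyMeasurable
    · filter_upwards [hbound] with x ⟨hpos, hu, hlog⟩
      rw [norm_eq_abs, abs_mul, abs_of_pos hpos]
      gcongr
  have hintf : Integrable (fun x ↦ (μ.rnDeriv ν x).toReal) ν := Measure.integrable_toReal_rnDeriv
  have hintf' : Integrable (fun x ↦ (μ.rnDeriv ν x).toReal - 1) ν :=
    hintf.sub (integrable_const _)
  rw [klDiv, if_pos hμν]
  refine ENNReal.ofReal_le_ofReal ?_
  calc ∫ x, log (μ.rnDeriv ν x).toReal ∂μ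
      = ∫ x, (μ.rnDeriv ν x).toReal * log (μ.rnDeriv ν x).toReal ∂ν :=
        (integral_rnDeriv_smul hμν).symm
    _ ≤ ∫ x, (ε * (exp ε - 1) + ((μ.rnDeriv ν x).toReal - 1)) ∂ν := by
        refine integral_mono_ae hint ((integrable_const _).add hintf') ?_
        filter_upwards [hbound] with x ⟨hpos, _, hlog⟩
        exact mul_log_le_of_log_abs_le hpos hlog
    _ = ε * (exp ε - 1) := by
        rw [integral_add (integrable_const _) hintf',
          integral_sub hintf (integrable_const _), Measure.integral_toReal_rnDeriv hμν]
        simp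
end

section
/- Let ε ≥ 0, let X and Z be measurable spaces, and let κ be a Markov kernel from X to Z such that κ(x)(S) ≤ e^ε κ(x')(S) for all x, x' ∈ X and all measurable S ⊆ Z. Then for any two probability measures μ₁ and μ₂ on X, the induced output distributions ν₁ = ∫ κ(x) dμ₁(x) and ν₂ = ∫ κ(x) dμ₂(x) satisfy ν₁(S) ≤ e^ε ν₂(S) and ν₂(S) ≤ e^ε ν₁(S) for every measurable S ⊆ Z, and consequently KL(ν₁‖ν₂) ≤ ε (e^ε − 1). -/
open MeasureTheory ProbabilityTheory Real ENNReal Classical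

/-- A measure dominated on measurable sets by `c` times another is absolutely continuous. -/
lemma absolutelyContinuous_of_forall_le_mul {Ω : Type*} [MeasurableSpace Ω] {μ ν : Measure Ω}
    {c : ℝ≥0∞} (h : ∀ S, MeasurableSet S → μ S ≤ c * ν S) : μ ≪ ν := by
  refine Measure.AbsolutelyContinuous.mk fun s hs h0 => ?_
  simpa [h0] using h s hs

lemma rnDeriv_le_const_of_forall_le_mul {Ω : Type*} [MeasurableSpace Ω] {μ ν : Measure Ω}
    [SigmaFinite ν] {c : ℝ≥0∞} (h : ∀ S, MeasurableSet S → μ S ≤ c * ν S) :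
    ∀ᵐ x ∂ν, μ.rnDeriv ν x ≤ c := by
  refine ae_le_of_forall_setLIntegral_le_of_sigmaFinite (μ.measurable_rnDeriv ν) fun s hs _ => ?_
  rw [setLIntegral_const]
  exact (Measure.setLIntegral_rnDeriv_le s).trans (h s hs)

lemma one_le_const_mul_rnDeriv_of_forall_le_mul {Ω : Type*} [MeasurableSpace Ω]
    {μ ν : Measure Ω} [SigmaFinite μ] [SigmaFinite ν] (hac : μ ≪ ν) {c : ℝ≥0∞}
    (h : ∀ S, MeasurableSet S → ν S ≤ c * μ S) :
    ∀ᵐ x ∂ν, 1 ≤ c * μ.rnDeriv ν x := by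
  refine ae_le_of_forall_setLIntegral_le_of_sigmaFinite measurable_const fun s hs _ => ?_
  rw [lintegral_const_mul _ (μ.measurable_rnDeriv ν), Measure.setLIntegral_rnDeriv hac,
    setLIntegral_one]
  exact h s hs

lemma bind_le_mul_bind {X Z : Type*} [MeasurableSpace X] [MeasurableSpace Z]
    {κ : Kernel X Z} {c : ℝ≥0∞}
    (h : ∀ x x' : X, ∀ S : Set Z, MeasurableSet S → κ x S ≤ c * κ x' S)
    (μ₁ μ₂ : Measure X) [IsProbabilityMeasure μ₁] [IsProbabilityMeasure μ₂]
    {S : Set Z} (hS : MeasurableSet S) :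
    μ₁.bind (fun x => κ x) S ≤ c * μ₂.bind (fun x => κ x) S := by
  rw [Measure.bind_apply hS κ.measurable.aemeasurable,
    Measure.bind_apply hS κ.measurable.aemeasurable,
    ← lintegral_const_mul _ (κ.measurable_coe hS)]
  calc ∫⁻ x, κ x S ∂μ₁ ≤ ∫⁻ _, (∫⁻ x', c * κ x' S ∂μ₂) ∂μ₁ := by
        refine lintegral_mono fun x => ?_
        calc κ x S = ∫⁻ _, κ x S ∂μ₂ := by simp
          _ ≤ ∫⁻ x', c * κ x' S ∂μ₂ := lintegral_mono fun x' => h x x' S hS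
    _ = ∫⁻ x', c * κ x' S ∂μ₂ := by simp

lemma mul_log_le_of_abs_log_le {ε r : ℝ} (hr : 0 < r) (h : |Real.log r| ≤ ε) :
    r * Real.log r ≤ ε * (Real.exp ε - 1) + (r - 1) := by
  obtain ⟨hl, hu⟩ := abs_le.mp h
  have hlog := Real.log_le_sub_one_of_pos hr
  have hexp := Real.add_one_le_exp ε
  have hre : r ≤ Real.exp ε := (Real.log_le_iff_le_exp hr).mp hu
  have key : (r - 1) * Real.log r ≤ ε * (Real.exp ε - 1) := by
    rcases le_total 1 r with h1 | h1
    · have := Real.log_nonneg h1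
      rw [mul_comm]
      exact mul_le_mul hu (by linarith) (by linarith) (by linarith)
    · have := Real.log_nonpos hr.le h1
      calc (r - 1) * Real.log r = (-Real.log r) * (1 - r) := by ring
        _ ≤ ε * (Real.exp ε - 1) :=
          mul_le_mul (by linarith) (by linarith) (by linarith) (by linarith)
  linarith

/-- Two probability measures within a multiplicative factor `e^ε` of each other have
Kullback–Leibler divergence at most `ε (e^ε − 1)`. -/
lemma klDiv_le_of_forall_le_exp_mul {Ω : Type*} [MeasurableSpace Ω] {μ ν : Measure Ω}
    [IsProbabilityMeasure μ] [IsProbabilityMeasure ν] {ε : ℝ}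
    (h₁ : ∀ S, MeasurableSet S → μ S ≤ ENNReal.ofReal (Real.exp ε) * ν S)
    (h₂ : ∀ S, MeasurableSet S → ν S ≤ ENNReal.ofReal (Real.exp ε) * μ S) :
    klDiv μ ν ≤ ENNReal.ofReal (ε * (Real.exp ε - 1)) := by
  have hac := absolutelyContinuous_of_forall_le_mul h₁
  rw [klDiv, if_pos hac]
  apply ENNReal.ofReal_le_ofReal
  have hbd : ∀ᵐ x ∂ν, 0 < (μ.rnDeriv ν x).toReal ∧ (μ.rnDeriv ν x).toReal ≤ Real.exp ε ∧
      |Real.log (μ.rnDeriv ν x).toReal| ≤ ε := by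
    filter_upwards [rnDeriv_le_const_of_forall_le_mul h₁,
      one_le_const_mul_rnDeriv_of_forall_le_mul hac h₂] with x hx hx'
    have hle : (μ.rnDeriv ν x).toReal ≤ Real.exp ε :=
      ENNReal.toReal_le_of_le_ofReal (Real.exp_pos ε).le hx
    have hge : 1 ≤ Real.exp ε * (μ.rnDeriv ν x).toReal := by
      have := ENNReal.toReal_mono
        (ENNReal.mul_ne_top ENNReal.ofReal_ne_top (ne_top_of_le_ne_top ENNReal.ofReal_ne_top hx))
        hx'
      simpa [ENNReal.toReal_mul, ENNReal.toReal_ofReal (Real.exp_pos ε).le] using this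
    have hpos : 0 < (μ.rnDeriv ν x).toReal :=
      pos_of_mul_pos_right (one_pos.trans_le hge) (Real.exp_pos ε).le
    have hlog := Real.log_nonneg hge
    rw [Real.log_mul (Real.exp_pos ε).ne' hpos.ne', Real.log_exp] at hlog
    exact ⟨hpos, hle, abs_le.mpr ⟨by linarith, (Real.log_le_iff_le_exp hpos).mpr hle⟩⟩
  have hint : Integrable (fun x => (μ.rnDeriv ν x).toReal) ν := Measure.integrable_toReal_rnDeriv
  have hint' : Integrable
      (fun x => (μ.rnDeriv ν x).toReal * Real.log (μ.rnDeriv ν x).toReal) ν := by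
    refine Integrable.of_bound (C := Real.exp ε * ε)
      (Measurable.aestronglyMeasurable (by fun_prop)) ?_
    filter_upwards [hbd] with x ⟨hpos, hle, hlog⟩
    rw [Real.norm_eq_abs, abs_mul, abs_of_pos hpos]
    exact mul_le_mul hle hlog (abs_nonneg _) (Real.exp_pos ε).le
  have hsub : Integrable (fun x => (μ.rnDeriv ν x).toReal - 1) ν :=
    hint.sub (integrable_const 1)
  calc ∫ x, Real.log (μ.rnDeriv ν x).toReal ∂μ
      = ∫ x, (μ.rnDeriv ν x).toReal * Real.log (μ.rnDeriv ν x).toReal ∂ν :=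
        (integral_rnDeriv_smul hac).symm
    _ ≤ ∫ x, (ε * (Real.exp ε - 1) + ((μ.rnDeriv ν x).toReal - 1)) ∂ν := by
        refine integral_mono_ae hint' ((integrable_const _).add hsub) ?_
        filter_upwards [hbd] with x ⟨hpos, _, hlog⟩
        exact mul_log_le_of_abs_log_le hpos hlog
    _ = ε * (Real.exp ε - 1) := by
        rw [integral_add (integrable_const _) hsub, integral_sub hint (integrable_const 1),
          Measure.integral_toReal_rnDeriv hac]
        simp

/-- Let `ε ≥ 0` and let `κ` be a Markov kernel from `X` to `Z` such that
`κ(x)(S) ≤ e^ε κ(x')(S)` for all `x, x'` and measurable `S`. Then for any probability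
measures `μ₁, μ₂` on `X`, the output distributions `ν₁ = μ₁.bind κ` and `ν₂ = μ₂.bind κ`
satisfy `ν₁(S) ≤ e^ε ν₂(S)` and `ν₂(S) ≤ e^ε ν₁(S)` for every measurable `S`, and
consequently `KL(ν₁‖ν₂) ≤ ε (e^ε − 1)`. -/
theorem ldp_kernel_outputs_close_and_kl_le {X Z : Type*}
    [MeasurableSpace X] [MeasurableSpace Z]
    (ε : ℝ) (hε : 0 ≤ ε)
    (κ : Kernel X Z) [IsMarkovKernel κ]
    (hdp : ∀ x x' : X, ∀ S : Set Z, MeasurableSet S →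
      κ x S ≤ ENNReal.ofReal (Real.exp ε) * κ x' S)
    (μ₁ μ₂ : Measure X) [IsProbabilityMeasure μ₁] [IsProbabilityMeasure μ₂] :
    (∀ S : Set Z, MeasurableSet S →
      μ₁.bind (fun x => κ x) S ≤ ENNReal.ofReal (Real.exp ε) * μ₂.bind (fun x => κ x) S) ∧
    (∀ S : Set Z, MeasurableSet S →
      μ₂.bind (fun x => κ x) S ≤ ENNReal.ofReal (Real.exp ε) * μ₁.bind (fun x => κ x) S) ∧
    klDiv (μ₁.bind (fun x => κ x)) (μ₂.bind (fun x => κ x)) ≤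
      ENNReal.ofReal (ε * (Real.exp ε - 1)) := by
  have : IsProbabilityMeasure (μ₁.bind (fun x => κ x)) :=
    inferInstanceAs (IsProbabilityMeasure (μ₁.bind κ))
  have : IsProbabilityMeasure (μ₂.bind (fun x => κ x)) :=
    inferInstanceAs (IsProbabilityMeasure (μ₂.bind κ))
  have h₁ := fun (S : Set Z) (hS : MeasurableSet S) => bind_le_mul_bind hdp μ₁ μ₂ hS
  have h₂ := fun (S : Set Z) (hS : MeasurableSet S) => bind_le_mul_bind hdp μ₂ μ₁ hS
  exact ⟨h₁, h₂, klDiv_le_of_forall_le_exp_mul h₁ h₂⟩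
end
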